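/- Let N ≥ 1, 0 < γ < min{2,N}, p > p_γ := 1 + (2−γ)/N, 0 < T < ∞ and z ∈ ℝ^N (z = 0 allowed). There exist constants c* > 0 and C* > 0 depending only on N, p, γ (and not on T or z) with the following property: if u₀ is a nonnegative measurable function on ℝ^N satisfying u₀(x) ≤ c |x−z|^{−(2−γ)/(p−1)} + C₀ for all x ∈ ℝ^N \ {z}, where 0 < c ≤ c* and 0 ≤ C₀ ≤ C* T^{−(2−γ)/(2(p−1))}, then the Hardy parabolic equation ∂_t u − Δu = |x|^{−γ} u^p with initial data u₀ possesses a solution on ℝ^N × [0,T). -/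

import Mathlib

open MeasureTheory Real Set

noncomputable def heatKernel (N : ℕ) (x : EuclideanSpace ℝ (Fin N)) (t : ℝ) : ℝ :=
  (4 * Real.pi * t) ^ (-(N : ℝ) / 2) * Real.exp (-‖x‖ ^ 2 / (4 * t))

/-- `u` is a (nonnegative, integral) solution of `∂_t u - Δu = |x|^{-γ} u^p`
with initial data the nonnegative measurable function `u₀`, on `ℝ^N × [0,T)`. -/
def IsSol (N : ℕ) (γ p T : ℝ) (u₀ : EuclideanSpace ℝ (Fin N) → ℝ)
    (u : EuclideanSpace ℝ (Fin N) → ℝ → ℝ) : Prop :=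
  Measurable (Function.uncurry u) ∧ (∀ x t, 0 ≤ u x t) ∧
    ∀ᵐ q : EuclideanSpace ℝ (Fin N) × ℝ,
      q.2 ∈ Set.Ioo 0 T →
        u q.1 q.2 = (∫ y, heatKernel N (q.1 - y) q.2 * u₀ y) +
          ∫ s in Set.Ioo 0 q.2, ∫ y,
            heatKernel N (q.1 - y) (q.2 - s) * ‖y‖ ^ (-γ) * u y s ^ p


open scoped ENNReal

section Integrals

lemma integral_Ioo_rpow {t r : ℝ} (ht : 0 < t) (hr : -1 < r) :
    ∫ s in Ioo 0 t, s ^ r = t ^ (r + 1) / (r + 1) := by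
  rw [← integral_Ioc_eq_integral_Ioo, ← intervalIntegral.integral_of_le ht.le,
    integral_rpow (Or.inl hr), Real.zero_rpow (by linarith), sub_zero]

lemma integrableOn_Ioo_zero_rpow {t r : ℝ} (ht : 0 < t) (hr : -1 < r) :
    IntegrableOn (fun s : ℝ => s ^ r) (Ioo 0 t) :=
  (((intervalIntegrable_iff_integrableOn_Ioc_of_le ht.le).1
    (intervalIntegral.intervalIntegrable_rpow' hr)).mono_set Ioo_subset_Ioc_self)

lemma lintegral_Ioo_rpow {t r : ℝ} (ht : 0 < t) (hr : -1 < r) :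
    ∫⁻ s in Ioo 0 t, ENNReal.ofReal (s ^ r) = ENNReal.ofReal (t ^ (r + 1) / (r + 1)) := by
  rw [← integral_Ioo_rpow ht hr,
    ofReal_integral_eq_lintegral_ofReal (integrableOn_Ioo_zero_rpow ht hr)]
  filter_upwards [ae_restrict_mem measurableSet_Ioo] with s hs
  exact Real.rpow_nonneg hs.1.le _

lemma lintegral_Ioo_sub_rpow {t r : ℝ} (ht : 0 < t) (hr : -1 < r) :
    ∫⁻ s in Ioo 0 t, ENNReal.ofReal ((t - s) ^ r) = ENNReal.ofReal (t ^ (r + 1) / (r + 1)) := by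
  rw [← lintegral_Ioo_rpow ht hr, ← lintegral_indicator measurableSet_Ioo,
    ← lintegral_indicator measurableSet_Ioo, ← lintegral_sub_left_eq_self _ t]
  refine lintegral_congr fun s => ?_
  by_cases hs : s ∈ Ioo 0 t
  · have : t - s ∈ Ioo 0 t := ⟨by linarith [hs.2], by linarith [hs.1]⟩
    simp [hs, this]
  · have : t - s ∉ Ioo 0 t := fun h => hs ⟨by linarith [h.2], by linarith [h.1]⟩
    simp only [indicator_of_notMem hs, indicator_of_notMem this]

lemma exists_lintegral_ball_norm_rpow_le {N : ℕ} (hN : 1 ≤ N) {μ : ℝ} (hμ : μ < N) :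
    ∃ C : ℝ, 0 < C ∧ ∀ R : ℝ, 0 < R →
      ∫⁻ y in Metric.ball (0 : EuclideanSpace ℝ (Fin N)) R, ENNReal.ofReal (‖y‖ ^ (-μ)) ≤
        ENNReal.ofReal (C * R ^ ((N : ℝ) - μ)) := by
  have : Nonempty (Fin N) := ⟨⟨0, hN⟩⟩
  set V : ℝ := volume.real (Metric.ball (0 : EuclideanSpace ℝ (Fin N)) 1)
  have hV : 0 < V := ENNReal.toReal_pos (Metric.measure_ball_pos _ _ one_pos).ne'
    measure_ball_lt_top.ne
  have hNpos : (0 : ℝ) < N := by exact_mod_cast hN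
  have hNμ : 0 < (N : ℝ) - μ := by linarith
  refine ⟨N * V / (N - μ), by positivity, fun R hR => ?_⟩
  have hpow : ∀ y ∈ Ioo 0 R, y ^ (N - 1) * y ^ (-μ) = y ^ ((N : ℝ) - 1 - μ) := by
    intro y hy
    rw [← Real.rpow_natCast, ← Real.rpow_add hy.1, Nat.cast_sub hN]
    congr 1
    push_cast
    ring
  have hint : IntegrableOn (fun y : EuclideanSpace ℝ (Fin N) => ‖y‖ ^ (-μ))
      (Metric.ball 0 R) := by
    rw [integrableOn_fun_norm_addHaar volume (f := fun r : ℝ => r ^ (-μ)),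
      finrank_euclideanSpace_fin]
    refine (integrableOn_Ioo_zero_rpow hR (r := (N : ℝ) - 1 - μ) (by linarith)).congr_fun
      (fun y hy => ?_) measurableSet_Ioo
    simp only [smul_eq_mul, hpow y hy]
  rw [← ofReal_integral_eq_lintegral_ofReal hint
    (Filter.Eventually.of_forall fun y => by positivity)]
  refine ENNReal.ofReal_le_ofReal (le_of_eq ?_)
  have h1 : ∫ y in Metric.ball (0 : EuclideanSpace ℝ (Fin N)) R, ‖y‖ ^ (-μ) =
      ∫ y : EuclideanSpace ℝ (Fin N), (Iio R).indicator (fun r : ℝ => r ^ (-μ)) ‖y‖ := by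
    rw [← integral_indicator measurableSet_ball]
    refine integral_congr_ae (Filter.Eventually.of_forall fun y => ?_)
    simp [indicator]
  have h2 : ∫ y in Ioi (0 : ℝ), y ^ (N - 1) • (Iio R).indicator (fun r : ℝ => r ^ (-μ)) y =
      ∫ y in Ioo 0 R, y ^ ((N : ℝ) - 1 - μ) := by
    rw [← integral_indicator measurableSet_Ioi, ← integral_indicator measurableSet_Ioo]
    refine integral_congr_ae (Filter.Eventually.of_forall fun y => ?_)
    by_cases h0 : 0 < y <;> by_cases hR' : y < R
    · simp [indicator, h0, hR', hpow y ⟨h0, hR'⟩]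
    all_goals simp [indicator, h0, hR']
  rw [h1, integral_fun_norm_addHaar volume, finrank_euclideanSpace_fin, h2,
    integral_Ioo_rpow hR (by linarith)]
  simp only [smul_eq_mul, nsmul_eq_mul]
  rw [show (N : ℝ) - 1 - μ + 1 = N - μ by ring]
  ring

end Integrals

section HeatKernel

variable {N : ℕ}

lemma heatKernel_nonneg (x : EuclideanSpace ℝ (Fin N)) {t : ℝ} (ht : 0 ≤ t) :
    0 ≤ heatKernel N x t := by
  unfold heatKernel
  positivity

lemma lintegral_heatKernel (x : EuclideanSpace ℝ (Fin N)) {t : ℝ} (ht : 0 < t) :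
    ∫⁻ y, ENNReal.ofReal (heatKernel N (x - y) t) = 1 := by
  rw [lintegral_sub_left_eq_self (fun y => ENNReal.ofReal (heatKernel N y t)) x]
  have hb : 0 < 1 / (4 * t) := by positivity
  have hG := GaussianFourier.integral_rexp_neg_mul_sq_norm
    (V := EuclideanSpace ℝ (Fin N)) hb
  have hpos : 0 < (4 * π * t) ^ ((N : ℝ) / 2) := by positivity
  rw [finrank_euclideanSpace_fin, show π / (1 / (4 * t)) = 4 * π * t by field_simp] at hG
  have hint : Integrable fun v : EuclideanSpace ℝ (Fin N) =>
      Real.exp (-(1 / (4 * t)) * ‖v‖ ^ 2) := by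
    by_contra h
    rw [integral_undef h] at hG
    exact hpos.ne hG
  have heq : ∀ y : EuclideanSpace ℝ (Fin N), heatKernel N y t =
      (4 * π * t) ^ (-(N : ℝ) / 2) * Real.exp (-(1 / (4 * t)) * ‖y‖ ^ 2) := by
    intro y
    unfold heatKernel
    congr 2
    ring
  simp_rw [heq]
  rw [← ofReal_integral_eq_lintegral_ofReal (hint.const_mul _)
    (Filter.Eventually.of_forall fun y => by positivity), integral_const_mul, hG,
    ← Real.rpow_add (by positivity)]
  simp [neg_div]

/-- The heat semigroup acting on nonnegative extended-valued functions. -/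
noncomputable def heatFlow (g : EuclideanSpace ℝ (Fin N) → ℝ≥0∞)
    (x : EuclideanSpace ℝ (Fin N)) (t : ℝ) : ℝ≥0∞ :=
  ∫⁻ y, ENNReal.ofReal (heatKernel N (x - y) t) * g y

/-- The Duhamel integral of a nonnegative extended-valued source term. -/
noncomputable def duhamel (F : ℝ → EuclideanSpace ℝ (Fin N) → ℝ≥0∞)
    (x : EuclideanSpace ℝ (Fin N)) (t : ℝ) : ℝ≥0∞ :=
  ∫⁻ s in Ioo 0 t, heatFlow (F s) x (t - s)

lemma heatFlow_mono_ae {g h : EuclideanSpace ℝ (Fin N) → ℝ≥0∞} (hgh : ∀ᵐ y, g y ≤ h y)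
    (x : EuclideanSpace ℝ (Fin N)) (t : ℝ) : heatFlow g x t ≤ heatFlow h x t :=
  lintegral_mono_ae (hgh.mono fun _ hy => mul_le_mul' le_rfl hy)

lemma heatFlow_mono {g h : EuclideanSpace ℝ (Fin N) → ℝ≥0∞} (hgh : ∀ y, g y ≤ h y)
    (x : EuclideanSpace ℝ (Fin N)) (t : ℝ) : heatFlow g x t ≤ heatFlow h x t :=
  heatFlow_mono_ae (Filter.Eventually.of_forall hgh) x t

lemma heatFlow_const_mul {c : ℝ≥0∞} (hc : c ≠ ∞) (g : EuclideanSpace ℝ (Fin N) → ℝ≥0∞)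
    (x : EuclideanSpace ℝ (Fin N)) (t : ℝ) :
    heatFlow (fun y => c * g y) x t = c * heatFlow g x t := by
  unfold heatFlow
  rw [← lintegral_const_mul' _ _ hc]
  simp_rw [mul_left_comm]

lemma heatFlow_const (c : ℝ≥0∞) (x : EuclideanSpace ℝ (Fin N)) {t : ℝ} (ht : 0 < t) :
    heatFlow (fun _ => c) x t = c := by
  unfold heatFlow
  rw [lintegral_mul_const _ (by unfold heatKernel; fun_prop), lintegral_heatKernel x ht, one_mul]

lemma heatFlow_add {g h : EuclideanSpace ℝ (Fin N) → ℝ≥0∞} (hg : Measurable g)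
    (x : EuclideanSpace ℝ (Fin N)) (t : ℝ) :
    heatFlow (fun y => g y + h y) x t = heatFlow g x t + heatFlow h x t := by
  unfold heatFlow
  simp_rw [mul_add]
  exact lintegral_add_left (.mul (by unfold heatKernel; fun_prop) hg) _

lemma heatFlow_translate (g : EuclideanSpace ℝ (Fin N) → ℝ≥0∞)
    (z x : EuclideanSpace ℝ (Fin N)) (t : ℝ) :
    heatFlow (fun y => g (y - z)) x t = heatFlow g (x - z) t := by
  unfold heatFlow
  rw [← lintegral_sub_right_eq_self
    (fun y => ENNReal.ofReal (heatKernel N (x - z - y) t) * g y) z]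
  simp

lemma measurable_heatFlow {F : ℝ → EuclideanSpace ℝ (Fin N) → ℝ≥0∞}
    (hF : Measurable (Function.uncurry F)) :
    Measurable fun q : EuclideanSpace ℝ (Fin N) × ℝ × ℝ => heatFlow (F q.2.1) q.1 q.2.2 := by
  unfold heatFlow heatKernel
  refine Measurable.lintegral_prod_right'
    (f := fun r : (EuclideanSpace ℝ (Fin N) × ℝ × ℝ) × EuclideanSpace ℝ (Fin N) =>
      ENNReal.ofReal ((4 * π * r.1.2.2) ^ (-(N : ℝ) / 2) *
        Real.exp (-‖r.1.1 - r.2‖ ^ 2 / (4 * r.1.2.2))) * F r.1.2.1 r.2) ?_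
  exact .mul (by fun_prop) (hF.comp (f := fun r : (EuclideanSpace ℝ (Fin N) × ℝ × ℝ) ×
    EuclideanSpace ℝ (Fin N) => (r.1.2.1, r.2)) (by fun_prop))

lemma duhamel_mono_ae {F G : ℝ → EuclideanSpace ℝ (Fin N) → ℝ≥0∞}
    (x : EuclideanSpace ℝ (Fin N)) {t : ℝ} (h : ∀ s ∈ Ioo 0 t, ∀ᵐ y, F s y ≤ G s y) :
    duhamel F x t ≤ duhamel G x t :=
  setLIntegral_mono' measurableSet_Ioo fun s hs => heatFlow_mono_ae (h s hs) x _

lemma duhamel_mono {F G : ℝ → EuclideanSpace ℝ (Fin N) → ℝ≥0∞}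
    (x : EuclideanSpace ℝ (Fin N)) {t : ℝ} (h : ∀ s ∈ Ioo 0 t, ∀ y, F s y ≤ G s y) :
    duhamel F x t ≤ duhamel G x t :=
  duhamel_mono_ae x fun s hs => Filter.Eventually.of_forall (h s hs)

lemma duhamel_const_mul {c : ℝ≥0∞} (hc : c ≠ ∞) (F : ℝ → EuclideanSpace ℝ (Fin N) → ℝ≥0∞)
    (x : EuclideanSpace ℝ (Fin N)) (t : ℝ) :
    duhamel (fun s y => c * F s y) x t = c * duhamel F x t := by
  unfold duhamel
  simp_rw [heatFlow_const_mul hc]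
  exact lintegral_const_mul' _ _ hc

lemma duhamel_add {F G : ℝ → EuclideanSpace ℝ (Fin N) → ℝ≥0∞}
    (hF : Measurable (Function.uncurry F)) (x : EuclideanSpace ℝ (Fin N)) (t : ℝ) :
    duhamel (fun s y => F s y + G s y) x t = duhamel F x t + duhamel G x t := by
  unfold duhamel
  have hFs : ∀ s, Measurable (F s) := fun s => hF.comp measurable_prodMk_left
  simp_rw [heatFlow_add (hFs _)]
  exact lintegral_add_left ((measurable_heatFlow hF).comp
    (f := fun s : ℝ => (x, s, t - s)) (by fun_prop)) _

lemma duhamel_translate (F : ℝ → EuclideanSpace ℝ (Fin N) → ℝ≥0∞)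
    (z x : EuclideanSpace ℝ (Fin N)) (t : ℝ) :
    duhamel (fun s y => F s (y - z)) x t = duhamel F (x - z) t := by
  unfold duhamel
  simp_rw [heatFlow_translate]

lemma heatFlow_norm_rpow_le {μ C : ℝ} (hμ0 : 0 < μ)
    (hC : ∀ R : ℝ, 0 < R →
      ∫⁻ y in Metric.ball (0 : EuclideanSpace ℝ (Fin N)) R, ENNReal.ofReal (‖y‖ ^ (-μ)) ≤
        ENNReal.ofReal (C * R ^ ((N : ℝ) - μ)))
    {D R t : ℝ} (hC0 : 0 < C) (hD : 0 < D) (hR : 0 < R) (ht : 0 < t)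
    (x : EuclideanSpace ℝ (Fin N))
    (hk : ∀ y : EuclideanSpace ℝ (Fin N), ‖y‖ < R →
      heatKernel N (x - y) t ≤ D * R ^ (-(N : ℝ))) :
    heatFlow (fun y => ENNReal.ofReal (‖y‖ ^ (-μ))) x t ≤
      ENNReal.ofReal ((D * C + 1) * R ^ (-μ)) := by
  unfold heatFlow
  rw [← lintegral_add_compl _ (measurableSet_ball (x := (0 : EuclideanSpace ℝ (Fin N))) (ε := R)),
    show (D * C + 1) * R ^ (-μ) = D * R ^ (-(N : ℝ)) * (C * R ^ ((N : ℝ) - μ)) + R ^ (-μ) by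
      have : R ^ (-μ) = R ^ (-(N : ℝ)) * R ^ ((N : ℝ) - μ) := by
        rw [← Real.rpow_add hR]; congr 1; ring
      rw [this]; ring,
    ENNReal.ofReal_add (by positivity) (by positivity)]
  gcongr
  · calc _ ≤ ∫⁻ y in Metric.ball (0 : EuclideanSpace ℝ (Fin N)) R,
          ENNReal.ofReal (D * R ^ (-(N : ℝ))) * ENNReal.ofReal (‖y‖ ^ (-μ)) := by
          refine setLIntegral_mono' measurableSet_ball fun y hy => ?_
          gcongr
          exact hk y (by simpa using hy)
      _ ≤ _ := by
          rw [lintegral_const_mul _ (by fun_prop), ENNReal.ofReal_mul (p := D * _) (by positivity)]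
          gcongr
          exact hC R hR
  · calc _ ≤ ∫⁻ y in (Metric.ball (0 : EuclideanSpace ℝ (Fin N)) R)ᶜ,
          ENNReal.ofReal (heatKernel N (x - y) t) * ENNReal.ofReal (R ^ (-μ)) := by
          refine setLIntegral_mono' measurableSet_ball.compl fun y hy => ?_
          have hRy : R ≤ ‖y‖ := by simpa using hy
          exact mul_le_mul' le_rfl (ENNReal.ofReal_le_ofReal
            (Real.rpow_le_rpow_of_nonpos hR hRy (by linarith)))
      _ ≤ ∫⁻ y, ENNReal.ofReal (heatKernel N (x - y) t) * ENNReal.ofReal (R ^ (-μ)) :=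
          setLIntegral_le_lintegral _ _
      _ = _ := by
          rw [lintegral_mul_const' _ _ ENNReal.ofReal_ne_top, lintegral_heatKernel x ht, one_mul]

lemma rpow_neg_le_of_le_mul {Y R k μ : ℝ} (hY : 0 < Y) (hk : 0 < k) (hR : 0 < R)
    (h : Y ≤ k * R) (hμ : 0 ≤ μ) : R ^ (-μ) ≤ k ^ μ * Y ^ (-μ) := by
  have h1 := Real.rpow_le_rpow_of_nonpos hY h (neg_nonpos.2 hμ)
  rw [Real.mul_rpow hk.le hR.le] at h1
  calc R ^ (-μ) = k ^ μ * (k ^ (-μ) * R ^ (-μ)) := by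
        rw [← mul_assoc, ← Real.rpow_add hk]; simp
    _ ≤ _ := by gcongr

lemma heatKernel_le_of_le_norm {w : EuclideanSpace ℝ (Fin N)} {R t : ℝ} (hR : 0 < R)
    (ht : 0 < t) (h : R ≤ ‖w‖) :
    heatKernel N w t ≤ π ^ (-(N : ℝ) / 2) * (1 + N.factorial) * R ^ (-(N : ℝ)) := by
  have hτ : 0 < R ^ 2 / (4 * t) := by positivity
  set τ := R ^ 2 / (4 * t)
  have h1 : (4 * π * t) ^ (-(N : ℝ) / 2) =
      π ^ (-(N : ℝ) / 2) * R ^ (-(N : ℝ)) * τ ^ ((N : ℝ) / 2) := by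
    have : 4 * π * t = π * R ^ 2 * τ⁻¹ := by simp only [τ]; field_simp
    rw [this, Real.mul_rpow (by positivity) (by positivity),
      Real.mul_rpow (by positivity) (by positivity), ← Real.rpow_natCast R 2,
      ← Real.rpow_mul hR.le, Real.inv_rpow hτ.le, ← Real.rpow_neg hτ.le]
    congr 2
    · congr 1; push_cast; ring
    · ring
  have h2 : Real.exp (-‖w‖ ^ 2 / (4 * t)) ≤ Real.exp (-τ) := by
    rw [Real.exp_le_exp, neg_div, neg_le_neg_iff]
    simp only [τ]
    gcongr
  have h3 : τ ^ ((N : ℝ) / 2) ≤ 1 + τ ^ N := by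
    rcases le_total τ 1 with h | h
    · exact (Real.rpow_le_one hτ.le h (by positivity)).trans (by simp; positivity)
    · calc τ ^ ((N : ℝ) / 2) ≤ τ ^ (N : ℝ) :=
            Real.rpow_le_rpow_of_exponent_le h (half_le_self (by positivity))
        _ ≤ _ := by rw [Real.rpow_natCast]; linarith
  have h4 : τ ^ N ≤ N.factorial * Real.exp τ := by
    have := Real.pow_div_factorial_le_exp τ hτ.le N
    rwa [div_le_iff₀ (by positivity), mul_comm] at this
  have h5 : τ ^ ((N : ℝ) / 2) * Real.exp (-τ) ≤ 1 + N.factorial := by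
    have h6 : 1 ≤ Real.exp τ := Real.one_le_exp hτ.le
    rw [Real.exp_neg, ← div_eq_mul_inv, div_le_iff₀ (Real.exp_pos _)]
    linarith
  unfold heatKernel
  calc _ ≤ (4 * π * t) ^ (-(N : ℝ) / 2) * Real.exp (-τ) := by gcongr
    _ = π ^ (-(N : ℝ) / 2) * (τ ^ ((N : ℝ) / 2) * Real.exp (-τ)) * R ^ (-(N : ℝ)) := by
        rw [h1]; ring
    _ ≤ _ := by gcongr

lemma exists_heatFlow_norm_rpow_le (hN : 1 ≤ N) {μ : ℝ} (hμ0 : 0 < μ) (hμ : μ < N) :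
    ∃ K : ℝ, 0 < K ∧ ∀ (x : EuclideanSpace ℝ (Fin N)) (t : ℝ), 0 < t →
      heatFlow (fun y => ENNReal.ofReal (‖y‖ ^ (-μ))) x t ≤
        ENNReal.ofReal (K * (‖x‖ + √t) ^ (-μ)) := by
  obtain ⟨C, hC0, hC⟩ := exists_lintegral_ball_norm_rpow_le hN hμ
  set D₁ : ℝ := (4 * π) ^ (-(N : ℝ) / 2)
  set D₂ : ℝ := π ^ (-(N : ℝ) / 2) * (1 + N.factorial)
  have hD₁ : 0 < D₁ := by positivity
  have hD₂ : 0 < D₂ := by positivity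
  refine ⟨(D₁ * C + 1) * 2 ^ μ + (D₂ * C + 1) * 4 ^ μ, by positivity, fun x t ht => ?_⟩
  have hst : 0 < √t := Real.sqrt_pos.2 ht
  have hY : 0 < ‖x‖ + √t := by positivity
  rcases le_or_gt ‖x‖ √t with hx | hx
  · refine (heatFlow_norm_rpow_le hμ0 hC hC0 hD₁ hst ht x fun y _ => ?_).trans
      (ENNReal.ofReal_le_ofReal ?_)
    · unfold heatKernel
      have : (4 * π * t) ^ (-(N : ℝ) / 2) = D₁ * √t ^ (-(N : ℝ)) := by
        rw [Real.mul_rpow (by positivity) ht.le, Real.sqrt_eq_rpow, ← Real.rpow_mul ht.le]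
        congr 2
        ring
      rw [this]
      refine mul_le_of_le_one_right (by positivity) (Real.exp_le_one_iff.2 ?_)
      rw [neg_div]
      exact neg_nonpos.2 (by positivity)
    · calc (D₁ * C + 1) * √t ^ (-μ) ≤ (D₁ * C + 1) * (2 ^ μ * (‖x‖ + √t) ^ (-μ)) := by
            gcongr
            exact rpow_neg_le_of_le_mul hY two_pos hst (by linarith) hμ0.le
        _ ≤ _ := by
            rw [← mul_assoc]
            gcongr
            exact le_add_of_nonneg_right (by positivity)
  · have hR : 0 < ‖x‖ / 2 := by linarith
    refine (heatFlow_norm_rpow_le hμ0 hC hC0 hD₂ hR ht x fun y hy => ?_).trans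
      (ENNReal.ofReal_le_ofReal ?_)
    · refine heatKernel_le_of_le_norm hR ht ?_
      have := norm_sub_norm_le x y
      linarith
    · calc (D₂ * C + 1) * (‖x‖ / 2) ^ (-μ) ≤ (D₂ * C + 1) * (4 ^ μ * (‖x‖ + √t) ^ (-μ)) := by
            gcongr
            exact rpow_neg_le_of_le_mul hY four_pos hR (by linarith) hμ0.le
        _ ≤ _ := by
            rw [← mul_assoc]
            gcongr
            exact le_add_of_nonneg_left (by positivity)

lemma rpow_weight_le {r s γ α μ : ℝ} (hr : 0 ≤ r) (hs : 0 < s) (hγ : 0 < γ) (hγμ : γ ≤ μ)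
    (hμα : μ ≤ α + 2) :
    r ^ (-γ) * (r + √s) ^ (-(α + 2 - γ)) ≤ s ^ (-(α + 2 - μ) / 2) * r ^ (-μ) := by
  rcases hr.eq_or_lt with rfl | hr
  · rw [Real.zero_rpow (by linarith), zero_mul]
    positivity
  have hss : 0 < √s := Real.sqrt_pos.2 hs
  have hY : 0 < r + √s := by positivity
  calc r ^ (-γ) * (r + √s) ^ (-(α + 2 - γ))
      = r ^ (-μ) * r ^ (μ - γ) * (r + √s) ^ (-(α + 2 - γ)) := by
        rw [← Real.rpow_add hr]; congr 2; ring
    _ ≤ r ^ (-μ) * (r + √s) ^ (μ - γ) * (r + √s) ^ (-(α + 2 - γ)) := by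
        gcongr
        linarith
    _ = r ^ (-μ) * (r + √s) ^ (-(α + 2 - μ)) := by
        rw [mul_assoc, ← Real.rpow_add hY]; congr 2; ring
    _ ≤ r ^ (-μ) * √s ^ (-(α + 2 - μ)) := by
        gcongr ?_ * ?_
        exact Real.rpow_le_rpow_of_nonpos hss (by linarith) (by linarith)
    _ = _ := by
        rw [Real.sqrt_eq_rpow, ← Real.rpow_mul hs.le, mul_comm]
        congr 2
        ring

lemma heatFlow_norm_rpow_mul_le {μ K c : ℝ} (hμ0 : 0 < μ) (hc : 0 ≤ c)
    (hK : ∀ (x : EuclideanSpace ℝ (Fin N)) (t : ℝ), 0 < t →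
      heatFlow (fun y => ENNReal.ofReal (‖y‖ ^ (-μ))) x t ≤
        ENNReal.ofReal (K * (‖x‖ + √t) ^ (-μ))) (hK0 : 0 < K)
    {g : EuclideanSpace ℝ (Fin N) → ℝ≥0∞} (hg : ∀ y, g y ≤ ENNReal.ofReal (c * ‖y‖ ^ (-μ)))
    (x : EuclideanSpace ℝ (Fin N)) {t r : ℝ} (ht : 0 < t) (hr : 0 < r) (hrx : r ≤ ‖x‖ + √t) :
    heatFlow g x t ≤ ENNReal.ofReal (c * (K * r ^ (-μ))) := by
  calc heatFlow g x t
      ≤ heatFlow (fun y => ENNReal.ofReal c * ENNReal.ofReal (‖y‖ ^ (-μ))) x t :=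
        heatFlow_mono (fun y => (hg y).trans_eq (ENNReal.ofReal_mul hc)) x t
    _ ≤ ENNReal.ofReal c * ENNReal.ofReal (K * (‖x‖ + √t) ^ (-μ)) := by
        rw [heatFlow_const_mul ENNReal.ofReal_ne_top]
        gcongr
        exact hK x t ht
    _ ≤ _ := by
        rw [← ENNReal.ofReal_mul hc]
        refine ENNReal.ofReal_le_ofReal ?_
        gcongr ?_ * (?_ * ?_)
        exact Real.rpow_le_rpow_of_nonpos hr hrx (by linarith)

lemma sqrt_rpow {t a : ℝ} (ht : 0 ≤ t) : √t ^ a = t ^ (a / 2) := by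
  rw [Real.sqrt_eq_rpow, ← Real.rpow_mul ht]
  congr 1
  ring

lemma exists_duhamel_norm_rpow_le (hN : 1 ≤ N) {γ : ℝ} (hγ0 : 0 < γ) (hγ : γ < min 2 (N : ℝ)) :
    ∃ K : ℝ, 0 < K ∧ ∀ (x : EuclideanSpace ℝ (Fin N)) (t : ℝ), 0 < t →
      duhamel (fun _ y => ENNReal.ofReal (‖y‖ ^ (-γ))) x t ≤
        ENNReal.ofReal (K * t ^ (1 - γ / 2)) := by
  have hγ2 : γ < 2 := hγ.trans_le (min_le_left _ _)
  obtain ⟨K, hK0, hK⟩ := exists_heatFlow_norm_rpow_le hN hγ0 (hγ.trans_le (min_le_right _ _))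
  have he : 0 < 1 - γ / 2 := by linarith
  refine ⟨K / (1 - γ / 2), by positivity, fun x t ht => ?_⟩
  calc duhamel (fun _ y => ENNReal.ofReal (‖y‖ ^ (-γ))) x t
      ≤ ∫⁻ s in Ioo 0 t, ENNReal.ofReal K * ENNReal.ofReal ((t - s) ^ (-γ / 2)) := by
        refine setLIntegral_mono' measurableSet_Ioo fun s hs => ?_
        have hts : 0 < t - s := by linarith [hs.2]
        rw [← ENNReal.ofReal_mul hK0.le, ← sqrt_rpow hts.le, ← one_mul (K * _)]
        exact heatFlow_norm_rpow_mul_le hγ0 zero_le_one hK hK0 (by simp) x hts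
          (Real.sqrt_pos.2 hts) (by simp)
    _ = _ := by
        rw [lintegral_const_mul _ (by fun_prop), lintegral_Ioo_sub_rpow ht (by linarith),
          ← ENNReal.ofReal_mul hK0.le, show -γ / 2 + 1 = 1 - γ / 2 by ring]
        congr 1
        ring

lemma exists_duhamel_weight_le (hN : 1 ≤ N) {γ α : ℝ} (hγ0 : 0 < γ)
    (hγ : γ < min 2 (N : ℝ)) (hα0 : 0 < α) (hα : α < N) :
    ∃ K : ℝ, 0 < K ∧ ∀ (x : EuclideanSpace ℝ (Fin N)) (t : ℝ), 0 < t →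
      duhamel (fun s y => ENNReal.ofReal (‖y‖ ^ (-γ) * (‖y‖ + √s) ^ (-(α + 2 - γ)))) x t ≤
        ENNReal.ofReal (K * (‖x‖ + √t) ^ (-α)) := by
  have hγ2 : γ < 2 := hγ.trans_le (min_le_left _ _)
  have hγN : γ < N := hγ.trans_le (min_le_right _ _)
  obtain ⟨μ, hμl, hμr⟩ : ∃ μ, max α γ < μ ∧ μ < min (N : ℝ) (α + 2) :=
    exists_between (max_lt (lt_min hα (by linarith)) (lt_min hγN (by linarith)))
  obtain ⟨hαμ, hγμ⟩ := max_lt_iff.1 hμl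
  obtain ⟨hμN, hμα⟩ := lt_min_iff.1 hμr
  have hμ0 : 0 < μ := hγ0.trans hγμ
  obtain ⟨Kμ, hKμ0, hKμ⟩ := exists_heatFlow_norm_rpow_le hN hμ0 hμN
  obtain ⟨Kγ, hKγ0, hKγ⟩ := exists_heatFlow_norm_rpow_le hN hγ0 hγN
  have he : 0 < (μ - α) / 2 := by linarith
  have hf : 0 < 1 - γ / 2 := by linarith
  set e := (μ - α) / 2 with hedef
  set A := Kμ / e
  set B := 2 ^ (μ / 2) * Kμ / e + 2 ^ ((α + 2 - γ) / 2) * Kγ / (1 - γ / 2)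
  have hA : 0 < A := by positivity
  have hB : 0 < B := by positivity
  refine ⟨(A + B) * 2 ^ α, by positivity, fun x t ht => ?_⟩
  have hst : 0 < √t := Real.sqrt_pos.2 ht
  have hY : 0 < ‖x‖ + √t := by positivity
  rcases le_or_gt √t ‖x‖ with hx | hx
  · have hx0 : 0 < ‖x‖ := by linarith
    calc _ ≤ ∫⁻ s in Ioo 0 t, ENNReal.ofReal (Kμ * ‖x‖ ^ (-μ)) *
            ENNReal.ofReal (s ^ (-(α + 2 - μ) / 2)) := by
          refine setLIntegral_mono' measurableSet_Ioo fun s hs => ?_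
          have hts : 0 < t - s := by linarith [hs.2]
          have hs0 : 0 < s := hs.1
          rw [mul_comm, ← ENNReal.ofReal_mul (by positivity)]
          exact heatFlow_norm_rpow_mul_le hμ0 (by positivity) hKμ hKμ0
            (fun y => ENNReal.ofReal_le_ofReal
              (rpow_weight_le (norm_nonneg y) hs0 hγ0 hγμ.le hμα.le)) x hts hx0 (by simp)
      _ = ENNReal.ofReal (Kμ * ‖x‖ ^ (-μ) * (t ^ e / e)) := by
          rw [lintegral_const_mul _ (by fun_prop), lintegral_Ioo_rpow ht (by linarith),
            ← ENNReal.ofReal_mul (by positivity),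
            show -(α + 2 - μ) / 2 + 1 = e by rw [hedef]; ring]
      _ ≤ _ := by
          refine ENNReal.ofReal_le_ofReal ?_
          have h1 : t ^ e ≤ ‖x‖ ^ (μ - α) := by
            rw [hedef, ← sqrt_rpow ht.le]
            gcongr
          calc Kμ * ‖x‖ ^ (-μ) * (t ^ e / e) ≤ Kμ * ‖x‖ ^ (-μ) * (‖x‖ ^ (μ - α) / e) := by
                gcongr
            _ = A * (‖x‖ ^ (-μ) * ‖x‖ ^ (μ - α)) := by simp only [A]; ring
            _ = A * ‖x‖ ^ (-α) := by rw [← Real.rpow_add hx0]; congr 2; ring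
            _ ≤ A * (2 ^ α * (‖x‖ + √t) ^ (-α)) := by
                gcongr
                exact rpow_neg_le_of_le_mul hY two_pos hx0 (by linarith) hα0.le
            _ ≤ _ := by
                rw [← mul_assoc]
                gcongr
                linarith
  · have ht2 : 0 < t / 2 := by linarith
    calc _ ≤ ∫⁻ s in Ioo 0 t, (ENNReal.ofReal (Kμ * (t / 2) ^ (-μ / 2)) *
            ENNReal.ofReal (s ^ (-(α + 2 - μ) / 2)) +
            ENNReal.ofReal ((t / 2) ^ (-(α + 2 - γ) / 2) * Kγ) *
            ENNReal.ofReal ((t - s) ^ (-γ / 2))) := by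
          refine setLIntegral_mono' measurableSet_Ioo fun s hs => ?_
          have hts : 0 < t - s := by linarith [hs.2]
          have hs0 : 0 < s := hs.1
          rcases le_total s (t / 2) with h | h
          · refine le_trans ?_ le_self_add
            rw [mul_comm, ← ENNReal.ofReal_mul (by positivity), ← sqrt_rpow (a := -μ) ht2.le]
            refine heatFlow_norm_rpow_mul_le hμ0 (by positivity) hKμ hKμ0
              (fun y => ENNReal.ofReal_le_ofReal
                (rpow_weight_le (norm_nonneg y) hs0 hγ0 hγμ.le hμα.le)) x hts
                (Real.sqrt_pos.2 ht2) ?_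
            have : √(t / 2) ≤ √(t - s) := Real.sqrt_le_sqrt (by linarith)
            linarith [norm_nonneg x]
          · refine le_trans ?_ le_add_self
            rw [← ENNReal.ofReal_mul (by positivity), mul_assoc, ← sqrt_rpow (a := -γ) hts.le]
            refine heatFlow_norm_rpow_mul_le hγ0 (by positivity) hKγ hKγ0
              (fun y => ENNReal.ofReal_le_ofReal ((rpow_weight_le (norm_nonneg y) hs0 hγ0 le_rfl
                (by linarith)).trans ?_)) x hts (Real.sqrt_pos.2 hts) (by simp)
            gcongr ?_ * ?_
            exact Real.rpow_le_rpow_of_nonpos ht2 h (by linarith)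
      _ = ENNReal.ofReal (Kμ * (t / 2) ^ (-μ / 2) * (t ^ e / e) +
            (t / 2) ^ (-(α + 2 - γ) / 2) * Kγ * (t ^ (1 - γ / 2) / (1 - γ / 2))) := by
          rw [lintegral_add_left (by fun_prop), lintegral_const_mul _ (by fun_prop),
            lintegral_const_mul _ (by fun_prop), lintegral_Ioo_rpow ht (by linarith),
            lintegral_Ioo_sub_rpow ht (by linarith),
            ← ENNReal.ofReal_mul (by positivity), ← ENNReal.ofReal_mul (by positivity),
            show -(α + 2 - μ) / 2 + 1 = e by rw [hedef]; ring,
            show -γ / 2 + 1 = 1 - γ / 2 by ring,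
            ← ENNReal.ofReal_add (by positivity) (by positivity)]
      _ ≤ _ := by
          refine ENNReal.ofReal_le_ofReal ?_
          have hhalf : ∀ b : ℝ, (t / 2) ^ (-b / 2) = 2 ^ (b / 2) * t ^ (-b / 2) := fun b => by
            rw [div_eq_mul_inv, Real.mul_rpow ht.le (by norm_num), Real.inv_rpow two_pos.le,
              ← Real.rpow_neg two_pos.le, mul_comm]
            congr 2
            ring
          calc _ = 2 ^ (μ / 2) * Kμ / e * (t ^ (-μ / 2) * t ^ e) +
                2 ^ ((α + 2 - γ) / 2) * Kγ / (1 - γ / 2) *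
                  (t ^ (-(α + 2 - γ) / 2) * t ^ (1 - γ / 2)) := by
                rw [hhalf, hhalf]; ring
            _ = B * √t ^ (-α) := by
                rw [← Real.rpow_add ht, ← Real.rpow_add ht, sqrt_rpow ht.le,
                  show -μ / 2 + e = -α / 2 by rw [hedef]; ring,
                  show -(α + 2 - γ) / 2 + (1 - γ / 2) = -α / 2 by ring]
                simp only [B]; ring
            _ ≤ B * (2 ^ α * (‖x‖ + √t) ^ (-α)) := by
                gcongr
                exact rpow_neg_le_of_le_mul hY two_pos hst (by linarith) hα0.le
            _ ≤ _ := by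
                rw [← mul_assoc]
                gcongr
                linarith

lemma exists_duhamel_shifted_weight_le (hN : 1 ≤ N) {γ α : ℝ} (hγ0 : 0 < γ)
    (hγ : γ < min 2 (N : ℝ)) (hα0 : 0 < α) (hα : α < N) :
    ∃ K : ℝ, 0 < K ∧ ∀ (x : EuclideanSpace ℝ (Fin N)) (a t : ℝ), 0 ≤ a → 0 < t →
      duhamel (fun s y => ENNReal.ofReal (‖y‖ ^ (-γ) * (‖y‖ + a + √s) ^ (-(α + 2 - γ)))) x t ≤
        ENNReal.ofReal (K * (‖x‖ + a + √t) ^ (-α)) := by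
  have hγ2 : γ < 2 := hγ.trans_le (min_le_left _ _)
  obtain ⟨K₁, hK₁0, hK₁⟩ := exists_duhamel_weight_le hN hγ0 hγ hα0 hα
  obtain ⟨K₂, hK₂0, hK₂⟩ := exists_duhamel_norm_rpow_le hN hγ0 hγ
  refine ⟨(K₁ + K₂) * 2 ^ α, by positivity, fun x a t ha ht => ?_⟩
  have hst : 0 < √t := Real.sqrt_pos.2 ht
  have hY : 0 < ‖x‖ + √t := by positivity
  have hY' : 0 < ‖x‖ + a + √t := by positivity
  rcases le_or_gt a (‖x‖ + √t) with hax | hax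
  · refine (duhamel_mono x fun s hs y => ?_).trans ((hK₁ x t ht).trans
      (ENNReal.ofReal_le_ofReal ?_))
    · have := Real.sqrt_pos.2 hs.1
      refine ENNReal.ofReal_le_ofReal ?_
      gcongr ?_ * ?_
      exact Real.rpow_le_rpow_of_nonpos (by positivity) (by linarith) (by linarith)
    · calc _ ≤ K₁ * (2 ^ α * (‖x‖ + a + √t) ^ (-α)) := by
            gcongr
            exact rpow_neg_le_of_le_mul hY' two_pos hY (by linarith) hα0.le
        _ ≤ _ := by
            rw [← mul_assoc]
            gcongr
            linarith
  · have ha0 : 0 < a := by linarith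
    calc _ ≤ duhamel (fun s y => ENNReal.ofReal (a ^ (-(α + 2 - γ))) *
            ENNReal.ofReal (‖y‖ ^ (-γ))) x t := by
          refine duhamel_mono x fun s hs y => ?_
          rw [← ENNReal.ofReal_mul (by positivity), mul_comm]
          refine ENNReal.ofReal_le_ofReal ?_
          gcongr ?_ * ?_
          exact Real.rpow_le_rpow_of_nonpos ha0
            (by linarith [norm_nonneg y, Real.sqrt_nonneg s]) (by linarith)
      _ ≤ ENNReal.ofReal (a ^ (-(α + 2 - γ)) * (K₂ * t ^ (1 - γ / 2))) := by
          rw [duhamel_const_mul ENNReal.ofReal_ne_top, ENNReal.ofReal_mul (by positivity)]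
          gcongr
          exact hK₂ x t ht
      _ ≤ _ := by
          refine ENNReal.ofReal_le_ofReal ?_
          have h1 : t ^ (1 - γ / 2) ≤ a ^ (2 - γ) := by
            rw [show 1 - γ / 2 = (2 - γ) / 2 by ring, ← sqrt_rpow ht.le]
            gcongr
            linarith [norm_nonneg x]
          calc _ ≤ a ^ (-(α + 2 - γ)) * (K₂ * a ^ (2 - γ)) := by gcongr
            _ = K₂ * (a ^ (-(α + 2 - γ)) * a ^ (2 - γ)) := by ring
            _ = K₂ * a ^ (-α) := by rw [← Real.rpow_add ha0]; congr 2; ring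
            _ ≤ K₂ * (2 ^ α * (‖x‖ + a + √t) ^ (-α)) := by
                gcongr
                exact rpow_neg_le_of_le_mul hY' two_pos ha0 (by linarith) hα0.le
            _ ≤ _ := by
                rw [← mul_assoc]
                gcongr
                linarith

lemma exists_duhamel_translated_weight_le (hN : 1 ≤ N) {γ α : ℝ} (hγ0 : 0 < γ)
    (hγ : γ < min 2 (N : ℝ)) (hα0 : 0 < α) (hα : α < N) :
    ∃ K : ℝ, 0 < K ∧ ∀ (z x : EuclideanSpace ℝ (Fin N)) (t : ℝ), 0 < t →
      duhamel (fun s y => ENNReal.ofReal (‖y‖ ^ (-γ) * (‖y - z‖ + √s) ^ (-(α + 2 - γ)))) x t ≤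
        ENNReal.ofReal (K * (‖x - z‖ + √t) ^ (-α)) := by
  have hγ2 : γ < 2 := hγ.trans_le (min_le_left _ _)
  have : Nonempty (Fin N) := ⟨⟨0, hN⟩⟩
  obtain ⟨K, hK0, hK⟩ := exists_duhamel_shifted_weight_le hN hγ0 hγ hα0 hα
  set L : ℝ := 3 ^ (α + 2 - γ)
  have hL : 0 < L := by positivity
  refine ⟨K + L * K, by positivity, fun z x t ht => ?_⟩
  have hst : 0 < √t := Real.sqrt_pos.2 ht
  set F : ℝ → EuclideanSpace ℝ (Fin N) → ℝ≥0∞ := fun s y =>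
    ENNReal.ofReal (‖y‖ ^ (-γ) * (‖y‖ + 0 + √s) ^ (-(α + 2 - γ)))
  set G : ℝ → EuclideanSpace ℝ (Fin N) → ℝ≥0∞ := fun s y =>
    ENNReal.ofReal (‖y‖ ^ (-γ) * (‖y‖ + ‖z‖ + √s) ^ (-(α + 2 - γ)))
  calc _ ≤ duhamel (fun s y => F s (y - z) + ENNReal.ofReal L * G s y) x t := by
        refine duhamel_mono_ae x fun s hs => ?_
        have hz : ∀ᵐ y : EuclideanSpace ℝ (Fin N), y ≠ z := by
          simp [ae_iff]
        filter_upwards [hz] with y hyz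
        have hss := Real.sqrt_pos.2 hs.1
        have hyz0 : 0 < ‖y - z‖ := norm_pos_iff.2 (sub_ne_zero.2 hyz)
        rcases le_or_gt ‖y - z‖ ‖y‖ with h | h
        · refine le_trans (ENNReal.ofReal_le_ofReal ?_) le_self_add
          rw [add_zero]
          gcongr ?_ * _
          exact Real.rpow_le_rpow_of_nonpos hyz0 h (by linarith)
        · refine le_trans ?_ le_add_self
          rw [← ENNReal.ofReal_mul hL.le]
          refine ENNReal.ofReal_le_ofReal ?_
          rw [mul_left_comm]
          gcongr ?_ * ?_
          refine rpow_neg_le_of_le_mul (by positivity) three_pos (by positivity) ?_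
            (by linarith)
          have h1 : ‖z‖ ≤ ‖y‖ + ‖y - z‖ := by
            have := norm_sub_le y (y - z)
            simpa using this
          linarith
    _ = duhamel F (x - z) t + ENNReal.ofReal L * duhamel G x t := by
        rw [duhamel_add, duhamel_translate, duhamel_const_mul ENNReal.ofReal_ne_top]
        simp only [F, Function.uncurry_def]
        fun_prop
    _ ≤ ENNReal.ofReal (K * (‖x - z‖ + 0 + √t) ^ (-α)) + ENNReal.ofReal L *
          ENNReal.ofReal (K * (‖x‖ + ‖z‖ + √t) ^ (-α)) := by
        gcongr
        · exact hK (x - z) 0 t le_rfl ht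
        · exact hK x ‖z‖ t (norm_nonneg z) ht
    _ ≤ _ := by
        rw [← ENNReal.ofReal_mul hL.le, ← ENNReal.ofReal_add (by positivity) (by positivity)]
        refine ENNReal.ofReal_le_ofReal ?_
        have h1 : (‖x‖ + ‖z‖ + √t) ^ (-α) ≤ (‖x - z‖ + √t) ^ (-α) :=
          Real.rpow_le_rpow_of_nonpos (by positivity) (by gcongr; exact norm_sub_le x z)
            (by linarith)
        rw [add_zero, add_mul, ← mul_assoc]
        gcongr

lemma measurable_duhamel {F : ℝ → EuclideanSpace ℝ (Fin N) → ℝ≥0∞}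
    (hF : Measurable (Function.uncurry F)) :
    Measurable fun q : EuclideanSpace ℝ (Fin N) × ℝ => duhamel F q.1 q.2 := by
  unfold duhamel
  simp_rw [← lintegral_indicator measurableSet_Ioo]
  refine Measurable.lintegral_prod_right'
    (f := fun r : (EuclideanSpace ℝ (Fin N) × ℝ) × ℝ =>
      (Ioo 0 r.1.2).indicator (fun s => heatFlow (F s) r.1.1 (r.1.2 - s)) r.2) ?_
  have hset : MeasurableSet {r : (EuclideanSpace ℝ (Fin N) × ℝ) × ℝ | r.2 ∈ Ioo 0 r.1.2} :=
    (measurableSet_lt measurable_const measurable_snd).inter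
      (measurableSet_lt measurable_snd (measurable_snd.comp measurable_fst))
  exact ((measurable_heatFlow hF).comp (f := fun r : (EuclideanSpace ℝ (Fin N) × ℝ) × ℝ =>
    (r.1.1, r.2, r.1.2 - r.2)) (by fun_prop)).indicator hset

lemma duhamel_iSup {F : ℕ → ℝ → EuclideanSpace ℝ (Fin N) → ℝ≥0∞}
    (hF : ∀ n, Measurable (Function.uncurry (F n))) (hmono : Monotone F)
    (x : EuclideanSpace ℝ (Fin N)) (t : ℝ) :
    duhamel (fun s y => ⨆ n, F n s y) x t = ⨆ n, duhamel (F n) x t := by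
  have hflow : ∀ s, heatFlow (fun y => ⨆ n, F n s y) x (t - s) =
      ⨆ n, heatFlow (F n s) x (t - s) := fun s => by
    unfold heatFlow
    simp_rw [ENNReal.mul_iSup]
    refine lintegral_iSup (fun n => .mul (by unfold heatKernel; fun_prop)
      ((hF n).comp measurable_prodMk_left)) fun m n hmn y => ?_
    gcongr
    exact hmono hmn s y
  unfold duhamel
  simp_rw [hflow]
  refine lintegral_iSup (fun n => (measurable_heatFlow (hF n)).comp
    (f := fun s : ℝ => (x, s, t - s)) (by fun_prop)) fun m n hmn s => ?_
  exact heatFlow_mono (hmono hmn s) x _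

end HeatKernel

section Existence

variable {N : ℕ}

/-- Picard iterates, started from zero, for the Hardy parabolic equation. -/
noncomputable def picardIterate (γ p : ℝ) (g : EuclideanSpace ℝ (Fin N) → ℝ≥0∞) :
    ℕ → ℝ → EuclideanSpace ℝ (Fin N) → ℝ≥0∞
  | 0 => fun _ _ => 0
  | n + 1 => fun t x => heatFlow g x t +
      duhamel (fun s y => ENNReal.ofReal (‖y‖ ^ (-γ)) * picardIterate γ p g n s y ^ p) x t

lemma measurable_weight_mul_rpow (γ p : ℝ) {U : ℝ → EuclideanSpace ℝ (Fin N) → ℝ≥0∞}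
    (hU : Measurable (Function.uncurry U)) :
    Measurable (Function.uncurry fun s y => ENNReal.ofReal (‖y‖ ^ (-γ)) * U s y ^ p) := by
  have h : Measurable fun q : ℝ × EuclideanSpace ℝ (Fin N) =>
      ENNReal.ofReal (‖q.2‖ ^ (-γ)) := by fun_prop
  exact h.mul (hU.pow_const p)

lemma measurable_picardIterate (γ p : ℝ) {g : EuclideanSpace ℝ (Fin N) → ℝ≥0∞}
    (hg : Measurable g) (n : ℕ) : Measurable (Function.uncurry (picardIterate γ p g n)) := by
  induction n with
  | zero => exact measurable_const
  | succ n ih =>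
    have h1 := (measurable_heatFlow (F := fun _ => g) (hg.comp measurable_snd)).comp
      (f := fun q : ℝ × EuclideanSpace ℝ (Fin N) => (q.2, 0, q.1)) (by fun_prop)
    have h2 := (measurable_duhamel (measurable_weight_mul_rpow γ p ih)).comp measurable_swap
    exact h1.add h2

lemma monotone_picardIterate (γ : ℝ) {p : ℝ} (hp : 0 ≤ p)
    (g : EuclideanSpace ℝ (Fin N) → ℝ≥0∞) : Monotone (picardIterate γ p g) := by
  refine monotone_nat_of_le_succ fun n => ?_
  induction n with
  | zero => exact fun _ _ => zero_le
  | succ n ih =>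
    intro t x
    refine add_le_add le_rfl (duhamel_mono x fun s _ y => ?_)
    gcongr
    exact ih s y

lemma picardIterate_le (γ : ℝ) {p T : ℝ} (hp : 0 ≤ p) {g : EuclideanSpace ℝ (Fin N) → ℝ≥0∞}
    {S : ℝ → EuclideanSpace ℝ (Fin N) → ℝ≥0∞}
    (hS : ∀ t ∈ Ioo 0 T, ∀ x, heatFlow g x t +
      duhamel (fun s y => ENNReal.ofReal (‖y‖ ^ (-γ)) * S s y ^ p) x t ≤ S t x)
    (n : ℕ) : ∀ t ∈ Ioo 0 T, ∀ x, picardIterate γ p g n t x ≤ S t x := by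
  induction n with
  | zero => exact fun _ _ _ => zero_le
  | succ n ih =>
    intro t ht x
    refine le_trans (add_le_add le_rfl (duhamel_mono x fun s hs y => ?_)) (hS t ht x)
    gcongr
    exact ih s ⟨hs.1, hs.2.trans ht.2⟩ y

lemma iSup_picardIterate_eq (γ : ℝ) {p : ℝ} (hp : 0 < p)
    {g : EuclideanSpace ℝ (Fin N) → ℝ≥0∞} (hg : Measurable g)
    (t : ℝ) (x : EuclideanSpace ℝ (Fin N)) :
    ⨆ n, picardIterate γ p g n t x = heatFlow g x t +
      duhamel (fun s y => ENNReal.ofReal (‖y‖ ^ (-γ)) *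
        (⨆ n, picardIterate γ p g n s y) ^ p) x t := by
  have hmono := monotone_picardIterate γ hp.le g
  have hpow : ∀ s y, ENNReal.ofReal (‖y‖ ^ (-γ)) * (⨆ n, picardIterate γ p g n s y) ^ p =
      ⨆ n, ENNReal.ofReal (‖y‖ ^ (-γ)) * picardIterate γ p g n s y ^ p := fun s y => by
    rw [← ENNReal.mul_iSup]
    congr 1
    exact (ENNReal.orderIsoRpow p hp).map_iSup _
  have hmono_tx : Monotone fun n => picardIterate γ p g n t x := fun m n h => hmono h t x
  simp_rw [hpow]
  rw [duhamel_iSup (fun n => measurable_weight_mul_rpow γ p (measurable_picardIterate γ p hg n)),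
    ENNReal.add_iSup, ← hmono_tx.iSup_nat_add 1]
  · rfl
  · exact fun m n h s y => mul_le_mul' le_rfl (ENNReal.rpow_le_rpow (hmono h s y) hp.le)

/-- The Hardy parabolic equation is solvable as soon as it has a finite supersolution. -/
lemma exists_isSol_of_supersolution {γ p T : ℝ} (hp : 0 < p)
    {u₀ : EuclideanSpace ℝ (Fin N) → ℝ} (hu₀ : Measurable u₀) (hu₀_nonneg : ∀ x, 0 ≤ u₀ x)
    {S : ℝ → EuclideanSpace ℝ (Fin N) → ℝ≥0∞} (hS_top : ∀ t ∈ Ioo 0 T, ∀ x, S t x ≠ ∞)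
    (hS : ∀ t ∈ Ioo 0 T, ∀ x, heatFlow (fun y => ENNReal.ofReal (u₀ y)) x t +
      duhamel (fun s y => ENNReal.ofReal (‖y‖ ^ (-γ)) * S s y ^ p) x t ≤ S t x) :
    ∃ u, IsSol N γ p T u₀ u := by
  set g : EuclideanSpace ℝ (Fin N) → ℝ≥0∞ := fun y => ENNReal.ofReal (u₀ y)
  have hg : Measurable g := hu₀.ennreal_ofReal
  set U : ℝ → EuclideanSpace ℝ (Fin N) → ℝ≥0∞ := fun t x => ⨆ n, picardIterate γ p g n t x
    with hUdef
  have hU : Measurable (Function.uncurry U) :=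
    Measurable.iSup fun n => measurable_picardIterate γ p hg n
  have hU_top : ∀ t ∈ Ioo 0 T, ∀ x, U t x ≠ ∞ := fun t ht x =>
    ne_top_of_le_ne_top (hS_top t ht x) (iSup_le fun n => picardIterate_le γ hp.le hS n t ht x)
  refine ⟨fun x t => (U t x).toReal, (hU.comp measurable_swap).ennreal_toReal,
    fun x t => ENNReal.toReal_nonneg, Filter.Eventually.of_forall ?_⟩
  rintro ⟨x, t⟩ ht
  change t ∈ Ioo 0 T at ht
  set F : ℝ → EuclideanSpace ℝ (Fin N) → ℝ≥0∞ := fun s y =>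
    ENNReal.ofReal (‖y‖ ^ (-γ)) * U s y ^ p
  have hF : Measurable (Function.uncurry F) := measurable_weight_mul_rpow γ p hU
  have heq : U t x = heatFlow g x t + duhamel F x t := iSup_picardIterate_eq γ hp hg t x
  have hfin : heatFlow g x t + duhamel F x t ≠ ∞ := heq ▸ hU_top t ht x
  obtain ⟨h1, h2⟩ := ENNReal.add_ne_top.1 hfin
  change (U t x).toReal = _
  rw [heq, ENNReal.toReal_add h1 h2]
  congr 1
  · rw [integral_eq_lintegral_of_nonneg_ae
      (Filter.Eventually.of_forall fun y => mul_nonneg (heatKernel_nonneg _ ht.1.le)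
        (hu₀_nonneg y))
      (Measurable.mul (by unfold heatKernel; fun_prop) hu₀).aestronglyMeasurable]
    congr 1
    exact lintegral_congr fun y => (ENNReal.ofReal_mul (heatKernel_nonneg _ ht.1.le)).symm
  · have hFm : Measurable fun s : ℝ => heatFlow (F s) x (t - s) :=
      (measurable_heatFlow hF).comp (f := fun s : ℝ => (x, s, t - s)) (by fun_prop)
    unfold duhamel
    rw [← integral_toReal hFm.aemeasurable (ae_lt_top hFm h2)]
    refine setIntegral_congr_fun measurableSet_Ioo fun s hs => ?_
    have hts : 0 ≤ t - s := by linarith [hs.2]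
    have hUs : Measurable (U s) := hU.comp measurable_prodMk_left
    have hk : Measurable fun y => heatKernel N (x - y) (t - s) * ‖y‖ ^ (-γ) := by
      unfold heatKernel; fun_prop
    change (heatFlow (F s) x (t - s)).toReal =
      ∫ y, heatKernel N (x - y) (t - s) * ‖y‖ ^ (-γ) * (U s y).toReal ^ p
    rw [integral_eq_lintegral_of_nonneg_ae
      (Filter.Eventually.of_forall fun y => mul_nonneg (mul_nonneg (heatKernel_nonneg _ hts)
        (by positivity)) (by positivity))
      (hk.mul (hUs.ennreal_toReal.pow_const p)).aestronglyMeasurable]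
    congr 1
    refine lintegral_congr fun y => ?_
    rw [mul_assoc, ENNReal.ofReal_mul (heatKernel_nonneg _ hts),
      ENNReal.ofReal_mul (by positivity), ← ENNReal.ofReal_rpow_of_nonneg
        ENNReal.toReal_nonneg hp.le,
      ENNReal.ofReal_toReal (hU_top s ⟨hs.1, hs.2.trans ht.2⟩ y)]

end Existence

lemma add_rpow_le_two_rpow_mul {a b p : ℝ} (ha : 0 ≤ a) (hb : 0 ≤ b) (hp : 0 ≤ p) :
    (a + b) ^ p ≤ 2 ^ p * a ^ p + 2 ^ p * b ^ p := by
  rw [← Real.mul_rpow two_pos.le ha, ← Real.mul_rpow two_pos.le hb]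
  rcases le_total a b with h | h
  · exact (Real.rpow_le_rpow (by positivity) (by linarith) hp).trans
      (le_add_of_nonneg_left (by positivity))
  · exact (Real.rpow_le_rpow (by positivity) (by linarith) hp).trans
      (le_add_of_nonneg_right (by positivity))

lemma rpow_le_mul_rpow_sub_one {b m p : ℝ} (hb : 0 ≤ b) (hbm : b ≤ m) (hp : 1 < p) :
    b ^ p ≤ b * m ^ (p - 1) := by
  rcases hb.eq_or_lt with rfl | hb
  · rw [Real.zero_rpow (by linarith), zero_mul]
  · calc b ^ p = b * b ^ (p - 1) := by
          rw [Real.rpow_sub_one hb.ne']; field_simp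
      _ ≤ _ := by gcongr

theorem statement4 (N : ℕ) (hN : 1 ≤ N) (γ p : ℝ)
    (hγ0 : 0 < γ) (hγ : γ < min 2 (N : ℝ)) (hp : 1 + (2 - γ) / (N : ℝ) < p) :
    ∃ cstar Cstar : ℝ, 0 < cstar ∧ 0 < Cstar ∧
      ∀ (T : ℝ), 0 < T →
      ∀ (z : EuclideanSpace ℝ (Fin N)),
      ∀ (u₀ : EuclideanSpace ℝ (Fin N) → ℝ) (c C₀ : ℝ),
        Measurable u₀ → (∀ x, 0 ≤ u₀ x) →
        0 < c → c ≤ cstar →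
        0 ≤ C₀ → C₀ ≤ Cstar * T ^ (-(2 - γ) / (2 * (p - 1))) →
        (∀ x, x ≠ z → u₀ x ≤ c * ‖x - z‖ ^ (-(2 - γ) / (p - 1)) + C₀) →
        ∃ u, IsSol N γ p T u₀ u := by
  have hγ2 : γ < 2 := hγ.trans_le (min_le_left _ _)
  have hNpos : (0 : ℝ) < N := by exact_mod_cast hN
  have : Nonempty (Fin N) := ⟨⟨0, hN⟩⟩
  have hp1 : 0 < p - 1 := by
    have : 0 < (2 - γ) / (N : ℝ) := div_pos (by linarith) hNpos
    linarith
  have hp1' : 1 < p := by linarith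
  set α : ℝ := (2 - γ) / (p - 1) with hα
  have hα0 : 0 < α := div_pos (by linarith) hp1
  have hαN : α < N := by
    rw [hα, div_lt_iff₀ hp1, ← div_lt_iff₀' hNpos]
    linarith
  have hαp : α * p = α + 2 - γ := by
    have : α * (p - 1) = 2 - γ := by rw [hα]; field_simp
    linarith
  obtain ⟨K₁, hK₁0, hK₁⟩ := exists_heatFlow_norm_rpow_le hN hα0 hαN
  obtain ⟨K₂, hK₂0, hK₂⟩ := exists_duhamel_norm_rpow_le hN hγ0 hγ
  obtain ⟨K₃, hK₃0, hK₃⟩ := exists_duhamel_translated_weight_le hN hγ0 hγ hα0 hαN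
  have hroot : ∀ K : ℝ, 0 < K → (K ^ (-1 / (p - 1))) ^ (p - 1) = K⁻¹ := fun K hK => by
    rw [← Real.rpow_mul hK.le, div_mul_cancel₀ _ hp1.ne', Real.rpow_neg_one]
  refine ⟨(2 * 2 ^ p * K₃) ^ (-1 / (p - 1)) / (2 * K₁),
    (2 * 2 ^ p * K₂) ^ (-1 / (p - 1)) / 2, by positivity, by positivity, ?_⟩
  intro T hT z u₀ c C₀ hu₀ hu₀_nonneg hc hc_le hC₀ hC₀_le hbound
  set A := 2 * c * K₁ with hAdef
  set B := 2 * C₀ with hBdef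
  have hA : 0 < A := by positivity
  have hB : 0 ≤ B := by positivity
  have hA_small : 2 ^ p * A ^ p * K₃ ≤ A / 2 := by
    have h1 : A ≤ (2 * 2 ^ p * K₃) ^ (-1 / (p - 1)) := by
      rw [le_div_iff₀ (by positivity)] at hc_le
      linarith
    have h2 := rpow_le_mul_rpow_sub_one hA.le h1 hp1'
    rw [hroot _ (by positivity)] at h2
    calc _ ≤ 2 ^ p * (A * (2 * 2 ^ p * K₃)⁻¹) * K₃ := by gcongr
      _ = _ := by field_simp
  have hB_small : 2 ^ p * B ^ p * (K₂ * T ^ (1 - γ / 2)) ≤ B / 2 := by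
    have h1 : B ≤ (2 * 2 ^ p * K₂) ^ (-1 / (p - 1)) * T ^ (-(2 - γ) / (2 * (p - 1))) := by
      linarith
    have h2 := rpow_le_mul_rpow_sub_one hB h1 hp1'
    rw [Real.mul_rpow (x := (2 * 2 ^ p * K₂) ^ (-1 / (p - 1))) (by positivity) (by positivity),
      hroot _ (by positivity), ← Real.rpow_mul hT.le,
      show -(2 - γ) / (2 * (p - 1)) * (p - 1) = -(1 - γ / 2) by field_simp,
      Real.rpow_neg hT.le] at h2
    calc _ ≤ 2 ^ p * (B * ((2 * 2 ^ p * K₂)⁻¹ * (T ^ (1 - γ / 2))⁻¹)) *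
          (K₂ * T ^ (1 - γ / 2)) := by gcongr
      _ = _ := by field_simp
  refine exists_isSol_of_supersolution (by linarith) hu₀ hu₀_nonneg
    (S := fun t x => ENNReal.ofReal (A * (‖x - z‖ + √t) ^ (-α) + B))
    (fun _ _ _ => ENNReal.ofReal_ne_top) fun t ht x => ?_
  have ht0 : 0 < t := ht.1
  have hlin : heatFlow (fun y => ENNReal.ofReal (u₀ y)) x t ≤
      ENNReal.ofReal (A / 2 * (‖x - z‖ + √t) ^ (-α) + B / 2) := by
    calc _ ≤ heatFlow (fun y => ENNReal.ofReal c * ENNReal.ofReal (‖y - z‖ ^ (-α)) +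
            ENNReal.ofReal C₀) x t := by
          refine heatFlow_mono_ae ?_ x t
          have hz : ∀ᵐ y : EuclideanSpace ℝ (Fin N), y ≠ z := by simp [ae_iff]
          filter_upwards [hz] with y hy
          rw [← ENNReal.ofReal_mul hc.le, ← ENNReal.ofReal_add (by positivity) hC₀]
          refine ENNReal.ofReal_le_ofReal ((hbound y hy).trans_eq ?_)
          rw [hα, neg_div]
      _ = ENNReal.ofReal c * heatFlow (fun y => ENNReal.ofReal (‖y‖ ^ (-α))) (x - z) t +
            ENNReal.ofReal C₀ := by
          rw [heatFlow_add (by fun_prop), heatFlow_const _ _ ht0,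
            heatFlow_const_mul ENNReal.ofReal_ne_top,
            heatFlow_translate (fun y => ENNReal.ofReal (‖y‖ ^ (-α)))]
      _ ≤ ENNReal.ofReal c * ENNReal.ofReal (K₁ * (‖x - z‖ + √t) ^ (-α)) +
            ENNReal.ofReal C₀ := by
          gcongr
          exact hK₁ _ t ht0
      _ = _ := by
          rw [← ENNReal.ofReal_mul hc.le, ← ENNReal.ofReal_add (by positivity) hC₀]
          congr 1
          rw [hAdef, hBdef]
          ring
  have hnonlin : duhamel (fun s y => ENNReal.ofReal (‖y‖ ^ (-γ)) *
      ENNReal.ofReal (A * (‖y - z‖ + √s) ^ (-α) + B) ^ p) x t ≤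
      ENNReal.ofReal (A / 2 * (‖x - z‖ + √t) ^ (-α) + B / 2) := by
    calc _ ≤ duhamel (fun s y => ENNReal.ofReal (2 ^ p * A ^ p) *
            ENNReal.ofReal (‖y‖ ^ (-γ) * (‖y - z‖ + √s) ^ (-(α + 2 - γ))) +
            ENNReal.ofReal (2 ^ p * B ^ p) * ENNReal.ofReal (‖y‖ ^ (-γ))) x t := by
          refine duhamel_mono x fun s hs y => ?_
          have hss := Real.sqrt_pos.2 hs.1
          rw [ENNReal.ofReal_rpow_of_nonneg (by positivity) (by linarith),
            ← ENNReal.ofReal_mul (by positivity), ← ENNReal.ofReal_mul (by positivity),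
            ← ENNReal.ofReal_mul (by positivity),
            ← ENNReal.ofReal_add (by positivity) (by positivity)]
          refine ENNReal.ofReal_le_ofReal ?_
          calc _ ≤ ‖y‖ ^ (-γ) * (2 ^ p * (A * (‖y - z‖ + √s) ^ (-α)) ^ p + 2 ^ p * B ^ p) := by
                gcongr
                exact add_rpow_le_two_rpow_mul (by positivity) hB (by linarith)
            _ = _ := by
                rw [Real.mul_rpow hA.le (by positivity), ← Real.rpow_mul (by positivity),
                  neg_mul, hαp]
                ring
      _ = ENNReal.ofReal (2 ^ p * A ^ p) * duhamel (fun s y =>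
            ENNReal.ofReal (‖y‖ ^ (-γ) * (‖y - z‖ + √s) ^ (-(α + 2 - γ)))) x t +
            ENNReal.ofReal (2 ^ p * B ^ p) *
              duhamel (fun _ y => ENNReal.ofReal (‖y‖ ^ (-γ))) x t := by
          rw [duhamel_add, duhamel_const_mul ENNReal.ofReal_ne_top,
            duhamel_const_mul ENNReal.ofReal_ne_top]
          simp only [Function.uncurry_def]
          fun_prop
      _ ≤ ENNReal.ofReal (2 ^ p * A ^ p) * ENNReal.ofReal (K₃ * (‖x - z‖ + √t) ^ (-α)) +
            ENNReal.ofReal (2 ^ p * B ^ p) * ENNReal.ofReal (K₂ * t ^ (1 - γ / 2)) := by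
          gcongr
          · exact hK₃ z x t ht0
          · exact hK₂ x t ht0
      _ ≤ _ := by
          rw [← ENNReal.ofReal_mul (by positivity), ← ENNReal.ofReal_mul (by positivity),
            ← ENNReal.ofReal_add (by positivity) (by positivity)]
          refine ENNReal.ofReal_le_ofReal (add_le_add ?_ ?_)
          · rw [← mul_assoc]
            gcongr
          · refine le_trans ?_ hB_small
            have htT : t ^ (1 - γ / 2) ≤ T ^ (1 - γ / 2) :=
              Real.rpow_le_rpow ht0.le ht.2.le (by linarith)
            gcongr
  refine (add_le_add hlin hnonlin).trans_eq ?_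
  rw [← ENNReal.ofReal_add (by positivity) (by positivity)]
  congr 1
  ring
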